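/- Let a(n) be the number of compositions of n that avoid, in the sense of containment, every member of the set {(2,5,2), (3,4,3), (4,2,4)}. Then in the ring of formal power series over ℚ, (Σ_{n≥0} a(n) xⁿ) · (x¹⁸ + 3x¹⁵ + 2x¹⁴ − 2x¹³ − 2x¹² + 3x¹¹ − 3x¹⁰ + x⁸ + x⁷ − x⁶ + 2x⁵ − x⁴ − 2x² + 3x − 1) = −(x¹⁷ + 3x¹⁴ + x¹³ − 3x¹¹ + x¹⁰ + x⁶ − x⁵ + x⁴ + x² − 2x + 1). -/

import Mathlib

/-- `Occurs b c i` says that the composition (list) `b = (b_1, …, b_s)` occurs in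
`c = (c_1, …, c_k)` at (0-indexed) position `i`: `i + s ≤ k` and `b_j ≤ c_{i+j}`
for all `0 ≤ j < s`. -/
def Occurs (b c : List ℕ) (i : ℕ) : Prop :=
  i + b.length ≤ c.length ∧ ∀ j < b.length, b.getD j 0 ≤ c.getD (i + j) 0

instance (b c : List ℕ) (i : ℕ) : Decidable (Occurs b c i) :=
  inferInstanceAs
    (Decidable (i + b.length ≤ c.length ∧ ∀ j < b.length, b.getD j 0 ≤ c.getD (i + j) 0))

/-- The composition `c` includes (contains) the composition `b`. -/
def Contains (c b : List ℕ) : Prop := ∃ i, Occurs b c i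

/-- The number of occurrences of `b` in `c` (number of positions at which `b` occurs). -/
def numOcc (b c : List ℕ) : ℕ :=
  ((Finset.range (c.length + 1)).filter fun i => Occurs b c i).card

local notation "x" => (PowerSeries.X : PowerSeries ℚ)

def Bad (p q r : ℕ) : Prop :=
  (2 ≤ p ∧ 5 ≤ q ∧ 2 ≤ r) ∨ (3 ≤ p ∧ 4 ≤ q ∧ 3 ≤ r) ∨ (4 ≤ p ∧ 2 ≤ q ∧ 4 ≤ r)

instance (p q r : ℕ) : Decidable (Bad p q r) := by unfold Bad; infer_instance

def Av : ℕ → ℕ → List ℕ → Prop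
  | _, _, [] => True
  | p, q, r :: l => ¬ Bad p q r ∧ Av q r l

lemma contains_cons (p q r b1 b2 b3 : ℕ) (l : List ℕ) :
    Contains (p :: q :: r :: l) [b1, b2, b3] ↔
      (b1 ≤ p ∧ b2 ≤ q ∧ b3 ≤ r) ∨ Contains (q :: r :: l) [b1, b2, b3] := by
  unfold Contains Occurs
  constructor
  · rintro ⟨i, h1, h2⟩
    cases i with
    | zero =>
      left
      have h20 := h2 0 (by simp)
      have h21 := h2 1 (by simp)
      have h22 := h2 2 (by simp)
      simp at h20 h21 h22
      exact ⟨h20, h21, h22⟩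
    | succ i =>
      right
      refine ⟨i, by simp at h1 ⊢; omega, fun j hj => ?_⟩
      have := h2 j hj
      rwa [show i + 1 + j = (i + j) + 1 by omega, List.getD_cons_succ] at this
  · rintro (⟨h1, h2, h3⟩ | ⟨i, h1, h2⟩)
    · refine ⟨0, by simp, fun j hj => ?_⟩
      have : j < 3 := by simpa using hj
      interval_cases j <;> simpa
    · refine ⟨i + 1, by simp at h1 ⊢; omega, fun j hj => ?_⟩
      have := h2 j hj
      rwa [show i + 1 + j = (i + j) + 1 by omega, List.getD_cons_succ]

lemma not_contains_short (b1 b2 b3 : ℕ) (l : List ℕ) (h : l.length < 3) :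
    ¬ Contains l [b1, b2, b3] := by
  rintro ⟨i, h1, -⟩
  simp at h1
  omega

def Good (l : List ℕ) : Prop :=
  ¬ Contains l [2, 5, 2] ∧ ¬ Contains l [3, 4, 3] ∧ ¬ Contains l [4, 2, 4]

lemma good_cons (p q : ℕ) (l : List ℕ) : Good (p :: q :: l) ↔ Av p q l := by
  induction l generalizing p q with
  | nil =>
    simp only [Av, iff_true]
    exact ⟨not_contains_short _ _ _ _ (by simp), not_contains_short _ _ _ _ (by simp),
      not_contains_short _ _ _ _ (by simp)⟩
  | cons r l ih =>
    simp only [Av, ← ih]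
    unfold Good Bad
    rw [contains_cons, contains_cons, contains_cons]
    tauto

lemma good_iff (l : List ℕ) : Good l ↔ Av 1 1 l := by
  match l with
  | [] =>
    simp only [Av, iff_true]
    exact ⟨not_contains_short _ _ _ _ (by simp), not_contains_short _ _ _ _ (by simp),
      not_contains_short _ _ _ _ (by simp)⟩
  | [a] =>
    have : Good [a] := ⟨not_contains_short _ _ _ _ (by simp), not_contains_short _ _ _ _ (by simp),
      not_contains_short _ _ _ _ (by simp)⟩
    simp [Av, this, Bad]
  | a :: b :: l =>
    rw [good_cons]
    simp [Av, Bad]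

lemma av_cap (q r : ℕ) (hr : 5 ≤ r) (l : List ℕ) : Av q r l ↔ Av q 5 l := by
  have key : ∀ a b, (Bad a r b ↔ Bad a 5 b) ∧ (Bad r a b ↔ Bad 5 a b) := by
    intro a b
    unfold Bad
    omega
  match l with
  | [] => simp [Av]
  | [a] => simp [Av, key]
  | a :: b :: l => simp [Av, key]

open Classical in
noncomputable def SS (p q n : ℕ) : Finset (List ℕ) :=
  ((Finset.univ : Finset (Composition n)).image Composition.blocks).filter (Av p q)

lemma mem_SS (p q n : ℕ) (l : List ℕ) :
    l ∈ SS p q n ↔ (∀ i ∈ l, 0 < i) ∧ l.sum = n ∧ Av p q l := by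
  unfold SS
  simp only [Finset.mem_filter, Finset.mem_image, Finset.mem_univ, true_and]
  constructor
  · rintro ⟨⟨c, rfl⟩, h⟩
    exact ⟨fun i hi => c.blocks_pos hi, c.blocks_sum, h⟩
  · rintro ⟨h1, h2, h3⟩
    exact ⟨⟨⟨l, fun {i} hi => h1 i hi, h2⟩, rfl⟩, h3⟩

noncomputable def cc (p q n : ℕ) : ℕ := (SS p q n).card

lemma SS_eq (p q n : ℕ) : SS p q n = (if n = 0 then {[]} else ∅) ∪
    (Finset.HasAntidiagonal.antidiagonal n).biUnion (fun ij =>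
      if ij.1 = 0 ∨ Bad p q ij.1 then ∅ else (SS q ij.1 ij.2).image (List.cons ij.1)) := by
  ext l
  simp only [Finset.mem_union, Finset.mem_biUnion, Finset.HasAntidiagonal.mem_antidiagonal, mem_SS]
  cases l with
  | nil =>
    constructor
    · rintro ⟨-, h, -⟩
      left
      simp at h
      simp [← h]
    · rintro (h | ⟨⟨i, j⟩, -, h⟩)
      · split_ifs at h with h0
        · simp [h0, Av]
        · simp at h
      · split_ifs at h <;> simp at h
  | cons a l =>
    constructor
    · rintro ⟨h1, h2, h3⟩
      right
      simp only [Av] at h3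
      refine ⟨(a, l.sum), by simpa using h2, ?_⟩
      have ha : 0 < a := h1 a (by simp)
      rw [if_neg (by simp only [not_or]; exact ⟨by omega, h3.1⟩)]
      refine Finset.mem_image_of_mem _ ?_
      rw [mem_SS]
      exact ⟨fun i hi => h1 i (by simp [hi]), rfl, h3.2⟩
    · rintro (h | ⟨⟨i, j⟩, hij, h⟩)
      · split_ifs at h <;> simp at h
      · split_ifs at h with h0
        · simp at h
        · simp only [Finset.mem_image, List.cons.injEq, mem_SS] at h
          obtain ⟨l', ⟨h1, h2, h3⟩, rfl, rfl⟩ := h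
          simp only [not_or] at h0
          simp only at hij
          refine ⟨?_, by simp [h2, hij], h0.2, h3⟩
          intro k hk
          rcases List.mem_cons.1 hk with rfl | hk
          · exact Nat.pos_of_ne_zero h0.1
          · exact h1 k hk

lemma cc_eq (p q n : ℕ) : cc p q n = (if n = 0 then 1 else 0) +
    ∑ ij ∈ Finset.HasAntidiagonal.antidiagonal n, if ij.1 = 0 ∨ Bad p q ij.1 then 0 else cc q ij.1 ij.2 := by
  unfold cc
  rw [SS_eq, Finset.card_union_of_disjoint, Finset.card_biUnion]
  · congr 1
    · split_ifs <;> simp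
    · refine Finset.sum_congr rfl fun ij _ => ?_
      split_ifs
      · simp
      · exact Finset.card_image_of_injective _ (List.cons_injective)
  · rintro ⟨i, j⟩ h ⟨i', j'⟩ h' hne
    simp only [Finset.HasAntidiagonal.mem_antidiagonal, Finset.mem_coe] at h h'
    rw [Function.onFun, Finset.disjoint_left]
    intro l hl hl'
    simp only at hl hl'
    split_ifs at hl hl' <;> simp at hl hl'
    obtain ⟨_, _, rfl⟩ := hl
    obtain ⟨_, _, h2⟩ := hl'
    simp only [List.cons.injEq] at h2
    apply hne
    ext <;> simp <;> omega
  · rw [Finset.disjoint_left]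
    intro l hl
    split_ifs at hl
    · simp at hl
      subst hl
      simp only [Finset.mem_biUnion, not_exists, not_and]
      rintro ⟨i, j⟩ - h
      split_ifs at h <;> simp at h
    · simp at hl

lemma cc_cap (q r n : ℕ) (hr : 5 ≤ r) : cc q r n = cc q 5 n := by
  unfold cc
  congr 1
  ext l
  simp only [mem_SS, av_cap q r hr]

noncomputable def FF (p q : ℕ) : PowerSeries ℚ := PowerSeries.mk fun n => (cc p q n : ℚ)

noncomputable def WW (k : ℕ) : PowerSeries ℚ :=
  PowerSeries.mk fun i => if min i 5 = k then 1 else 0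

lemma FF_eq (p q : ℕ) : FF p q = 1 +
    ∑ k ∈ Finset.Icc 1 5, WW k * (if Bad p q k then 0 else FF q k) := by
  ext n
  rw [map_add, map_sum, FF, PowerSeries.coeff_mk, cc_eq, PowerSeries.coeff_one]
  push_cast
  congr 1
  simp only [PowerSeries.coeff_mul]
  rw [Finset.sum_comm (s := Finset.Icc 1 5)]
  refine Finset.sum_congr rfl fun ij _ => ?_
  obtain ⟨i, j⟩ := ij
  have h1 : ∀ k, (PowerSeries.coeff i) (WW k) = if min i 5 = k then 1 else 0 := by
    intro k; simp [WW]
  simp only [h1, ite_mul, one_mul, zero_mul]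
  rw [Finset.sum_ite_eq]
  have hB : Bad p q (min i 5) ↔ Bad p q i := by unfold Bad; omega
  have hc : cc q (min i 5) j = cc q i j := by
    rcases le_total i 5 with h | h
    · rw [min_eq_left h]
    · rw [min_eq_right h, cc_cap q i j h]
  by_cases h0 : i = 0
  · simp [h0]
  · have hm : min i 5 ∈ Finset.Icc 1 5 := by rw [Finset.mem_Icc]; omega
    rw [if_pos hm]
    simp only [h0, false_or, hB]
    split_ifs
    · simp
    · simp [FF, hc]

lemma WW_small (k : ℕ) (hk : k < 5) : WW k = x ^ k := by
  ext n
  rw [WW, PowerSeries.coeff_mk, PowerSeries.coeff_X_pow]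
  congr 1
  simp; omega

lemma WW_five : (1 - x) * WW 5 = x ^ 5 := by
  ext n
  rw [sub_mul, one_mul, map_sub, PowerSeries.coeff_X_pow]
  cases n with
  | zero => simp [WW]
  | succ n =>
    rw [mul_comm, PowerSeries.coeff_succ_mul_X, WW, PowerSeries.coeff_mk, PowerSeries.coeff_mk]
    split_ifs <;> first | omega | simp

lemma FF_eq' (p q : ℕ) : FF p q = 1 + x * (if Bad p q 1 then 0 else FF q 1)
    + x ^ 2 * (if Bad p q 2 then 0 else FF q 2) + x ^ 3 * (if Bad p q 3 then 0 else FF q 3)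
    + x ^ 4 * (if Bad p q 4 then 0 else FF q 4) + WW 5 * (if Bad p q 5 then 0 else FF q 5) := by
  rw [FF_eq]
  simp only [Finset.sum_Icc_succ_top (show 1 ≤ 4 + 1 by norm_num),
    Finset.sum_Icc_succ_top (show 1 ≤ 3 + 1 by norm_num),
    Finset.sum_Icc_succ_top (show 1 ≤ 2 + 1 by norm_num),
    Finset.sum_Icc_succ_top (show 1 ≤ 1 + 1 by norm_num), Finset.Icc_self, Finset.sum_singleton]
  norm_num only
  rw [WW_small 1, WW_small 2, WW_small 3, WW_small 4] <;> try norm_num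
  ring

/-- States with the same last part and the same set of forbidden continuations agree. -/
lemma FF_congr (p p' q : ℕ) (h : ∀ k ∈ Finset.Icc 1 5, Bad p q k ↔ Bad p' q k) :
    FF p q = FF p' q := by
  rw [FF_eq p q, FF_eq p' q]
  congr 1
  refine Finset.sum_congr rfl fun k hk => ?_
  simp only [h k hk]

lemma FF_main : FF 1 1 * (x ^ 18 + 3 * x ^ 15 + 2 * x ^ 14 - 2 * x ^ 13 - 2 * x ^ 12 + 3 * x ^ 11
          - 3 * x ^ 10 + x ^ 8 + x ^ 7 - x ^ 6 + 2 * x ^ 5 - x ^ 4 - 2 * x ^ 2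
          + 3 * x - 1) =
      -(x ^ 17 + 3 * x ^ 14 + x ^ 13 - 3 * x ^ 11 + x ^ 10 + x ^ 6 - x ^ 5 + x ^ 4
          + x ^ 2 - 2 * x + 1) := by
  have e21 := FF_congr 2 1 1 (by decide)
  have e31 := FF_congr 3 1 1 (by decide)
  have e41 := FF_congr 4 1 1 (by decide)
  have e51 := FF_congr 5 1 1 (by decide)
  have e22 := FF_congr 2 1 2 (by decide)
  have e32 := FF_congr 3 1 2 (by decide)
  have e23 := FF_congr 2 1 3 (by decide)
  have e33 := FF_congr 3 1 3 (by decide)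
  have e24 := FF_congr 2 1 4 (by decide)
  have e35 := FF_congr 3 2 5 (by decide)
  have e45 := FF_congr 4 2 5 (by decide)
  have e55 := FF_congr 5 2 5 (by decide)
  have e44 := FF_congr 4 3 4 (by decide)
  have e54 := FF_congr 5 3 4 (by decide)
  have e52 := FF_congr 5 4 2 (by decide)
  have e53 := FF_congr 5 4 3 (by decide)
  have h0 := FF_eq' 1 1
  have h1 := FF_eq' 1 2
  have h2 := FF_eq' 1 3
  have h3 := FF_eq' 1 4
  have h15 := FF_eq' 1 5
  have h4 := FF_eq' 2 5
  have h5 := FF_eq' 3 4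
  have h6 := FF_eq' 4 2
  have h43 := FF_eq' 4 3
  simp [Bad, e21, e31, e41, e51, e22, e32, e23, e33, e24, e35, e45, e55, e44, e54, e52, e53]
    at h0 h1 h2 h3 h15 h4 h5 h6 h43
  have hW := WW_five
  have e43 : FF 4 3 = FF 4 2 := by rw [h43, h6]
  rw [e43] at h3 h15
  have e15 : FF 1 5 = FF 1 4 := by rw [h15, h3]
  rw [e15] at h0
  clear h43 h15 e43 e15 e21 e31 e41 e51 e22 e32 e23 e33 e24 e35 e45 e55 e44 e54 e52 e53
  generalize FF 1 1 = F0 at *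
  generalize FF 1 2 = F1 at *
  generalize FF 1 3 = F2 at *
  generalize FF 1 4 = F3 at *
  generalize FF 2 5 = F4 at *
  generalize FF 3 4 = F5 at *
  generalize FF 4 2 = F6 at *
  generalize WW 5 = W at *
  generalize x = z at *
  obtain ⟨u, hu⟩ : ∃ u, u = 1 + z * F0 := ⟨_, rfl⟩
  obtain ⟨v, hv⟩ : ∃ v, v = z ^ 2 * F1 + z ^ 3 * F2 := ⟨_, rfl⟩
  have k4 : F4 = u := by rw [h4, hu]
  have k6 : F6 = u + v := by rw [h6, hu, hv]; ring
  have k5 : F5 = u + z ^ 2 * (u + v) := by rw [h5, k6, hu]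
  rw [k4, k5] at h2
  rw [k4] at h1
  rw [k4, k5, k6] at h3
  have k3 : (1 - z) * F3 = ((1 - z) * (1 + z ^ 2 + z ^ 3 + z ^ 4 + z ^ 6) + z ^ 5) * u
      + (1 - z) * (z ^ 2 + z ^ 3 + z ^ 6) * v := by
    linear_combination (1 - z) * h3 + u * hW - (1 - z) * hu
  have k2 : (1 - z) * F2 = (1 - z) * (u + v + z ^ 4 * (u + z ^ 2 * (u + v))) + z ^ 5 * u := by
    linear_combination (1 - z) * h2 + u * hW - (1 - z) * hu - (1 - z) * hv
  have k1 : (1 - z) * F1 = (1 - z) * (u + v + z ^ 4 * F3) + z ^ 5 * u := by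
    linear_combination (1 - z) * h1 + u * hW - (1 - z) * hu - (1 - z) * hv
  have k0 : (1 - z) * F0 = (1 - z) * (u + v) + z ^ 4 * F3 := by
    linear_combination (1 - z) * h0 + F3 * hW - (1 - z) * hu - (1 - z) * hv
  have kv : (1 - z) * v = z ^ 2 * ((1 - z) * (u + v) + z ^ 5 * u
      + z ^ 4 * (((1 - z) * (1 + z ^ 2 + z ^ 3 + z ^ 4 + z ^ 6) + z ^ 5) * u
      + (1 - z) * (z ^ 2 + z ^ 3 + z ^ 6) * v))
      + z ^ 3 * ((1 - z) * (u + v + z ^ 4 * (u + z ^ 2 * (u + v))) + z ^ 5 * u) := by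
    linear_combination (1 - z) * hv + z ^ 2 * k1 + z ^ 3 * k2 + z ^ 6 * k3
  have kF : (1 - z) ^ 2 * F0 = (1 - z) ^ 2 * (u + v)
      + z ^ 4 * (((1 - z) * (1 + z ^ 2 + z ^ 3 + z ^ 4 + z ^ 6) + z ^ 5) * u
      + (1 - z) * (z ^ 2 + z ^ 3 + z ^ 6) * v) := by
    linear_combination (1 - z) * k0 + z ^ 4 * k3
  clear h0 h1 h2 h3 h4 h5 h6 k0 k1 k2 k3 k4 k5 k6 hv hW
  subst hu
  linear_combination (-(1 - z ^ 2 - z ^ 3 - z ^ 6 * (z ^ 2 + z ^ 3 + z ^ 6) - z ^ 9)) * kF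
    - ((1 - z) + z ^ 4 * (z ^ 2 + z ^ 3 + z ^ 6)) * kv

/-- Theorem 2 of the paper: if `a n` is the number of compositions of `n` avoiding
(by containment) all of `(2,5,2)`, `(3,4,3)`, `(4,2,4)`, then in `ℚ[[x]]` the
generating function `∑ a(n) xⁿ` times the stated degree-18 polynomial equals minus
the stated degree-17 polynomial. -/
theorem gf_avoid_252_343_424 (a : ℕ → ℕ)
    (ha : ∀ n, a n = Nat.card {c : Composition n //
      ¬ Contains c.blocks [2, 5, 2] ∧ ¬ Contains c.blocks [3, 4, 3] ∧
        ¬ Contains c.blocks [4, 2, 4]}) :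
    PowerSeries.mk (fun n => (a n : ℚ)) *
        (x ^ 18 + 3 * x ^ 15 + 2 * x ^ 14 - 2 * x ^ 13 - 2 * x ^ 12 + 3 * x ^ 11
          - 3 * x ^ 10 + x ^ 8 + x ^ 7 - x ^ 6 + 2 * x ^ 5 - x ^ 4 - 2 * x ^ 2
          + 3 * x - 1) =
      -(x ^ 17 + 3 * x ^ 14 + x ^ 13 - 3 * x ^ 11 + x ^ 10 + x ^ 6 - x ^ 5 + x ^ 4
          + x ^ 2 - 2 * x + 1) := by
  have hF : PowerSeries.mk (fun n => (a n : ℚ)) = FF 1 1 := by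
    ext n
    rw [FF, PowerSeries.coeff_mk, PowerSeries.coeff_mk, ha, cc]
    norm_cast
    classical
    rw [Nat.card_eq_fintype_card, Fintype.card_subtype]
    rw [← Finset.card_image_of_injective (f := Composition.blocks) _
      (fun c d h => Composition.ext h)]
    congr 1
    ext l
    rw [mem_SS, ← good_iff, Finset.mem_image]
    constructor
    · rintro ⟨c, hc, rfl⟩
      exact ⟨fun i hi => c.blocks_pos hi, c.blocks_sum, (Finset.mem_filter.1 hc).2⟩
    · rintro ⟨h1, h2, h3⟩
      exact ⟨⟨l, fun {i} hi => h1 i hi, h2⟩, Finset.mem_filter.2 ⟨Finset.mem_univ _, h3⟩, rfl⟩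
  rw [hF]
  exact FF_main
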